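/- Strength law for the Elgot iteration of the duration monad: let τ_{Z,X} : Z × Q X → Q(Z × X) be the strength of Q, given by τ(z, (d, x)) = (d, (z, x)) and τ(z, c) = c for c ∈ [0,∞]. Then for every map f : X → Q(Y ⊕ X), τ ∘ (id_Z × f‡) = ((Q dist) ∘ τ ∘ (id_Z × f))‡, where dist : Z × (Y ⊕ X) → (Z × Y) ⊕ (Z × X) is the canonical distributivity isomorphism and Q h denotes the functorial action of Q. -/

import Mathlib

set_option autoImplicit false

open scoped NNReal ENNReal

/-! ### The duration monad `Q` -/

/-- The duration monad: `Q X = ([0,∞) × X) ⊕ [0,∞]`. -/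
abbrev Q (X : Type) : Type := (ℝ≥0 × X) ⊕ ℝ≥0∞

/-- Unit of `Q` : `η x = (0, x)`. -/
def Q.eta {X : Type} (x : X) : Q X := Sum.inl (0, x)

/-- Kleisli lifting of `Q`. -/
noncomputable def Q.bind {X Y : Type} (f : X → Q Y) : Q X → Q Y
  | Sum.inl (d, x) =>
      match f x with
      | Sum.inl (e, y) => Sum.inl (d + e, y)
      | Sum.inr c => Sum.inr ((d : ℝ≥0∞) + c)
  | Sum.inr c => Sum.inr c

/-- Functorial action of `Q`. -/
def Q.map {X Y : Type} (h : X → Y) : Q X → Q Y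
  | Sum.inl (d, x) => Sum.inl (d, h x)
  | Sum.inr c => Sum.inr c

/-- Strength of `Q`. -/
def Q.tau {Z X : Type} : Z × Q X → Q (Z × X)
  | (z, Sum.inl (d, x)) => Sum.inl (d, (z, x))
  | (_, Sum.inr c) => Sum.inr c

/-! ### The layered duration monad `Q̂` -/

/-- The layered duration monad: `Q̂ X = (W × X) ⊕ S`, where `W` is the set of
finite words over `[0,∞)` and `S` is the set of infinite streams over
`[0,∞)`. -/
abbrev QHat (X : Type) : Type := (List ℝ≥0 × X) ⊕ (ℕ → ℝ≥0)

/-- Unit of `Q̂` : `η̂ x = (ε, x)`. -/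
def QHat.eta {X : Type} (x : X) : QHat X := Sum.inl ([], x)

/-- The stream obtained by prefixing the stream `s` with the finite word `w`. -/
def prefixStream (w : List ℝ≥0) (s : ℕ → ℝ≥0) : ℕ → ℝ≥0 := fun k =>
  if h : k < w.length then w.get ⟨k, h⟩ else s (k - w.length)

/-- Kleisli lifting of `Q̂`. -/
def QHat.bind {X Y : Type} (f : X → QHat Y) : QHat X → QHat Y
  | Sum.inl (w, x) =>
      match f x with
      | Sum.inl (u, y) => Sum.inl (w ++ u, y)
      | Sum.inr s => Sum.inr (prefixStream w s)
  | Sum.inr s => Sum.inr s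

/-- A map `f : X → Q̂ (Y ⊕ X)` is guarded if whenever `f x = (w, inr z)`, the
word `w` is non-empty. -/
def QHat.Guarded {X Y : Type} (f : X → QHat (Y ⊕ X)) : Prop :=
  ∀ (x : X) (w : List ℝ≥0) (z : X), f x = Sum.inl (w, Sum.inr z) → w ≠ []

/-- `g` solves the fixpoint equation `g = [η̂, g]* ∘ f` characterising the
iteration `f†` of `f`. -/
def QHat.IsDagger {X Y : Type} (f : X → QHat (Y ⊕ X)) (g : X → QHat Y) : Prop :=
  g = fun x => QHat.bind (Sum.elim QHat.eta g) (f x)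

/-- The quotienting map `ρ : Q̂ X → Q X`, summing up words and streams of
durations. -/
noncomputable def QRho {X : Type} : QHat X → Q X
  | Sum.inl (w, x) => Sum.inl (w.sum, x)
  | Sum.inr s => Sum.inr (∑' i : ℕ, (s i : ℝ≥0∞))

/-- The section `υ : Q X → Q̂ X` of `ρ`. -/
noncomputable def QUps {X : Type} : Q X → QHat X
  | Sum.inl (d, x) => Sum.inl ([d], x)
  | Sum.inr c =>
      if c = ⊤ then Sum.inr (fun _ => 1)
      else Sum.inr (fun k => if k = 0 then c.toNNReal else 0)

/-- The canonical distributivity isomorphism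
`dist : Z × (Y ⊕ X) → (Z × Y) ⊕ (Z × X)`. -/
def qdist {Z Y X : Type} : Z × (Y ⊕ X) → (Z × Y) ⊕ (Z × X)
  | (z, Sum.inl y) => Sum.inl (z, y)
  | (z, Sum.inr x) => Sum.inr (z, x)

/-- Prefixing by a one-letter word. -/
theorem prefixStream_single_zero (d : ℝ≥0) (s : ℕ → ℝ≥0) : prefixStream [d] s 0 = d := by
  simp [prefixStream]

theorem prefixStream_single_succ (d : ℝ≥0) (s : ℕ → ℝ≥0) (n : ℕ) :
    prefixStream [d] s (n + 1) = s n := by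
  simp [prefixStream]

/-- Strength of the layered duration monad. -/
def QHat.tau {Z X : Type} (z : Z) : QHat X → QHat (Z × X)
  | Sum.inl (w, x) => Sum.inl (w, (z, x))
  | Sum.inr s => Sum.inr s

/-- The layered strength commutes with the two iterations. -/
theorem dagger_strength {X Y Z : Type} (f : X → Q (Y ⊕ X))
    (df : X → QHat Y) (hdf : QHat.IsDagger (fun x => QUps (f x)) df)
    (dg : Z × X → QHat (Z × Y))
    (hdg : QHat.IsDagger
      (fun zx : Z × X => QUps (Q.map qdist (Q.tau (zx.1, f zx.2)))) dg) (z : Z) (x : X) :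
    QHat.tau z (df x) = dg (z, x) := by
  have hf : ∀ x, df x = QHat.bind (Sum.elim QHat.eta df) (QUps (f x)) :=
    fun x => congrFun hdf x
  have hg : ∀ x, dg (z, x) = QHat.bind (Sum.elim QHat.eta dg)
      (QUps (Q.map qdist (Q.tau (z, f x)))) := fun x => congrFun hdg (z, x)
  have key : ∀ x, (QHat.tau z (df x) = dg (z, x)) ∨
      ∃ d x', df x = QHat.bind df (Sum.inl ([d], x')) ∧
        dg (z, x) = QHat.bind dg (Sum.inl ([d], (z, x'))) := by
    intro x
    have h1 := hf x
    have h2 := hg x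
    rcases hfx : f x with ⟨d, y | x'⟩ | c
    · left
      rw [h1, h2, hfx]
      simp [QHat.tau, QUps, Q.map, Q.tau, qdist, QHat.bind, QHat.eta]
    · right
      refine ⟨d, x', ?_, ?_⟩
      · rw [h1, hfx]
        simp [QUps, QHat.bind]
      · rw [h2, hfx]
        simp [QUps, QHat.bind, Q.map, Q.tau, qdist]
    · left
      rw [h1, h2, hfx]
      by_cases hc : c = ⊤ <;> simp [QHat.tau, QUps, Q.map, Q.tau, QHat.bind, hc]
  have k1 : ∀ (w : List ℝ≥0) x y, df x = Sum.inl (w, y) → dg (z, x) = Sum.inl (w, (z, y)) := by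
    intro w
    induction w with
    | nil =>
      intro x y h
      rcases key x with hk | ⟨d, x', e1, e2⟩
      · rw [← hk, h]; rfl
      · rcases hx : df x' with ⟨u, y'⟩ | s <;> simp [QHat.bind, hx, h] at e1
    | cons a w ih =>
      intro x y h
      rcases key x with hk | ⟨d, x', e1, e2⟩
      · rw [← hk, h]; rfl
      · rcases hx : df x' with ⟨u, y'⟩ | s
        · simp [QHat.bind, hx, h] at e1
          obtain ⟨⟨rfl, rfl⟩, rfl⟩ := e1
          rw [e2]
          simp [QHat.bind, ih _ _ hx]
        · simp [QHat.bind, hx, h] at e1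
  have k2 : ∀ (w : List ℝ≥0) x p, dg (z, x) = Sum.inl (w, p) →
      QHat.tau z (df x) = dg (z, x) := by
    intro w
    induction w with
    | nil =>
      intro x p h
      rcases key x with hk | ⟨d, x', e1, e2⟩
      · exact hk
      · rcases hx : dg (z, x') with ⟨u, y'⟩ | s <;> simp [QHat.bind, hx, h] at e2
    | cons a w ih =>
      intro x p h
      rcases key x with hk | ⟨d, x', e1, e2⟩
      · exact hk
      · rcases hx : dg (z, x') with ⟨u, p'⟩ | s
        · have e3 := e2
          simp [QHat.bind, hx, h] at e3
          obtain ⟨⟨rfl, rfl⟩, rfl⟩ := e3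
          have h3 := ih _ _ hx
          rw [hx] at h3
          rcases hx' : df x' with ⟨u, y'⟩ | s
          · rw [hx'] at h3
            simp [QHat.tau] at h3
            obtain ⟨rfl, rfl⟩ := h3
            rw [e1, h]
            simp [QHat.bind, hx', QHat.tau]
          · rw [hx'] at h3
            simp [QHat.tau] at h3
        · simp [QHat.bind, hx, h] at e2
  have k3 : ∀ (n : ℕ) x s t, df x = Sum.inr s → dg (z, x) = Sum.inr t → s n = t n := by
    intro n
    induction n with
    | zero =>
      intro x s t h1 h2
      rcases key x with hk | ⟨d, x', e1, e2⟩
      · rw [h1, h2] at hk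
        simp [QHat.tau] at hk
        rw [hk]
      · rcases hx : df x' with ⟨u, y'⟩ | s' <;> rcases hy : dg (z, x') with ⟨v, p⟩ | t' <;>
          simp [QHat.bind, hx, hy, h1, h2] at e1 e2
        rw [e1, e2, prefixStream_single_zero, prefixStream_single_zero]
    | succ n ih =>
      intro x s t h1 h2
      rcases key x with hk | ⟨d, x', e1, e2⟩
      · rw [h1, h2] at hk
        simp [QHat.tau] at hk
        rw [hk]
      · rcases hx : df x' with ⟨u, y'⟩ | s' <;> rcases hy : dg (z, x') with ⟨v, p⟩ | t' <;>
          simp [QHat.bind, hx, hy, h1, h2] at e1 e2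
        rw [e1, e2, prefixStream_single_succ, prefixStream_single_succ]
        exact ih _ _ _ hx hy
  rcases hx : df x with ⟨w, y⟩ | s
  · rw [k1 _ _ _ hx]; rfl
  · rcases hy : dg (z, x) with ⟨v, p⟩ | t
    · have := k2 _ _ _ hy
      rw [hx, hy] at this
      exact this
    · simp only [QHat.tau]
      congr 1
      funext n
      exact k3 n x s t hx hy

/-- **Strength law** for the Elgot iteration `f‡ = ρ ∘ (υ ∘ f)†` of the
duration monad: `τ ∘ (id_Z × f‡) = ((Q dist) ∘ τ ∘ (id_Z × f))‡`.  The
daggers are rendered as the unique solutions of their characterising fixpoint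
equations. -/
theorem elgot_strength_law {X Y Z : Type} (f : X → Q (Y ⊕ X))
    (df : X → QHat Y) (hdf : QHat.IsDagger (fun x => QUps (f x)) df)
    (dg : Z × X → QHat (Z × Y))
    (hdg : QHat.IsDagger
      (fun zx : Z × X => QUps (Q.map qdist (Q.tau (zx.1, f zx.2)))) dg) :
    (fun zx : Z × X => Q.tau (zx.1, QRho (df zx.2))) =
      (fun zx : Z × X => QRho (dg zx)) := by
  funext zx
  obtain ⟨z, x⟩ := zx
  have h := dagger_strength f df hdf dg hdg z x
  show Q.tau (z, QRho (df x)) = QRho (dg (z, x))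
  rw [← h]
  rcases df x with ⟨w, y⟩ | s <;> rfl
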